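/- arXiv:1901.07831 — 3 statements merged into one kernel-verified Lean document; each statement's English description precedes it below -/
import Mathlib

section
/- The normalized determinant H̃_t(x,y) = H_t(x,y)/∫_C H_t(x,y)dy, where H_t(x,y) = det(sech(π(y_j-x_i)/(2t))/(2t)), converges as x → 0 in the Weyl chamber C = {x_n < ... < x_1} to (1/M_t) ∏_j sech(πy_j/(2t)) ∏_{i<j}(tanh(πy_i/(2t)) - tanh(πy_j/(2t))), pointwise for y ∈ C. -/
open Real Finset Filter MeasureTheory Topology

theorem Matrix.det_one_sub_mul_inv {K : Type*} [Field K] {n : ℕ} (u v : Fin n → K)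
    (h : ∀ i j, 1 - u i * v j ≠ 0) :
    (Matrix.of fun i j => (1 - u i * v j)⁻¹).det =
      (∏ i, ∏ j ∈ Ioi i, (u i - u j)) * (∏ i, ∏ j ∈ Ioi i, (v i - v j)) *
        ∏ i, ∏ j, (1 - u i * v j)⁻¹ := by
  induction n with
  | zero => simp
  | succ n ih =>
    let B : Matrix (Fin (n + 1)) (Fin (n + 1)) K := Matrix.of fun i j =>
      if i = 0 then (1 - u 0 * v j)⁻¹
      else ((u 0 - u i) * (1 - u i * v 0)⁻¹) *
        (((v 0 - v j) * (1 - u 0 * v j)⁻¹) * (1 - u i * v j)⁻¹)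
    have hB : (Matrix.of fun i j => (1 - u i * v j)⁻¹).det = B.det := by
      refine Matrix.det_eq_of_forall_row_eq_smul_add_const
        (fun i => if i = 0 then 0 else (1 - u 0 * v 0) * (1 - u i * v 0)⁻¹) 0 (by simp) ?_
      intro i j
      by_cases hi : i = 0
      · simp [B, hi]
      · have h1 := h i j
        have h2 := h i 0
        have h3 := h 0 j
        simp only [B, Matrix.of_apply, hi, if_false, if_true]
        generalize u i = a, u 0 = b, v j = c, v 0 = d at h1 h2 h3 ⊢
        have h4 : 1 - c * b ≠ 0 := mul_comm b c ▸ h3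
        field_simp
        ring
    have hsub : B.submatrix Fin.succ Fin.succ = Matrix.of fun i j : Fin n =>
        ((u 0 - u i.succ) * (1 - u i.succ * v 0)⁻¹) *
          (Matrix.of fun i j : Fin n => ((v 0 - v j.succ) * (1 - u 0 * v j.succ)⁻¹) *
            (Matrix.of fun i j : Fin n => (1 - u i.succ * v j.succ)⁻¹) i j) i j := by
      ext i j
      simp [B]
    rw [hB, Matrix.det_succ_column_zero, Fin.sum_univ_succ, Finset.sum_eq_zero]
    · rw [Fin.succAbove_zero, hsub, Matrix.det_mul_column, Matrix.det_mul_row,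
        ih (fun i => u i.succ) (fun i => v i.succ) (fun i j => h _ _)]
      simp only [Fin.prod_univ_succ, Fin.Ioi_zero_eq_map, Finset.prod_map, Fin.coe_succEmb,
        Fin.prod_Ioi_succ, prod_mul_distrib, B, Matrix.of_apply]
      simp
      ring
    · intro i _
      simp [B]

theorem Real.tanh_sub_tanh (x y : ℝ) : tanh x - tanh y = sinh (x - y) / (cosh x * cosh y) := by
  have hx := (cosh_pos x).ne'
  have hy := (cosh_pos y).ne'
  rw [tanh_eq_sinh_div_cosh, tanh_eq_sinh_div_cosh, sinh_sub]
  field_simp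

theorem Real.strictMono_tanh : StrictMono tanh := fun x y h => by
  rw [← sub_pos, tanh_sub_tanh]
  exact div_pos (sinh_pos_iff.2 (sub_pos.2 h)) (mul_pos (cosh_pos _) (cosh_pos _))

theorem Real.continuous_tanh : Continuous tanh := by
  simp_rw [funext tanh_eq_sinh_div_cosh]
  exact continuous_sinh.div₀ continuous_cosh fun x => (cosh_pos x).ne'

theorem Real.one_sub_tanh_mul_tanh_pos (x y : ℝ) : 0 < 1 - tanh x * tanh y := by
  have := mul_lt_one_of_nonneg_of_lt_one_left (abs_nonneg _) (abs_tanh_lt_one x)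
    (abs_tanh_lt_one y).le
  rw [← abs_mul] at this
  linarith [le_abs_self (tanh x * tanh y)]

theorem Real.inv_cosh_sub (x y : ℝ) :
    (cosh (y - x))⁻¹ = (cosh x)⁻¹ * ((cosh y)⁻¹ * (1 - tanh x * tanh y)⁻¹) := by
  have hx := (cosh_pos x).ne'
  have hy := (cosh_pos y).ne'
  rw [← mul_inv, ← mul_inv, tanh_eq_sinh_div_cosh, tanh_eq_sinh_div_cosh, cosh_sub]
  congr 1
  field_simp

theorem Real.one_add_sq_le_four_mul_cosh (x : ℝ) : 1 + x ^ 2 ≤ 4 * cosh x := by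
  rw [← cosh_abs, ← sq_abs, cosh_eq]
  have := quadratic_le_exp_of_nonneg (abs_nonneg x)
  linarith [exp_pos (-|x|), abs_nonneg x]

theorem Real.integrable_inv_cosh : Integrable fun x : ℝ => (cosh x)⁻¹ := by
  refine (integrable_inv_one_add_sq.const_mul 4).mono'
    (continuous_cosh.inv₀ fun x => (cosh_pos x).ne').aestronglyMeasurable (.of_forall fun x => ?_)
  have hx := cosh_pos x
  rw [norm_of_nonneg (inv_nonneg.2 hx.le), ← div_eq_mul_inv, inv_le_comm₀ hx (by positivity),
    inv_div, div_le_iff₀' (by norm_num)]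
  exact one_add_sq_le_four_mul_cosh x

theorem isOpen_setOf_strictAnti {ι α : Type*} [Finite ι] [Preorder ι] [LinearOrder α]
    [TopologicalSpace α] [OrderClosedTopology α] : IsOpen {x : ι → α | StrictAnti x} := by
  simp only [StrictAnti, Set.ofPred_forall]
  exact isOpen_iInter_of_finite fun i => isOpen_iInter_of_finite fun j =>
    isOpen_iInter_of_finite fun _ => isOpen_lt (continuous_apply j) (continuous_apply i)

/-- The unnormalized density obtained when the starting points merge. -/
noncomputable def sechTanhDensity {n : ℕ} (t : ℝ) (y : Fin n → ℝ) : ℝ :=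
  (∏ j, (cosh (π * y j / (2 * t)))⁻¹) *
    ∏ i, ∏ j ∈ univ.filter (fun j => i < j), (tanh (π * y i / (2 * t)) - tanh (π * y j / (2 * t)))

/-- The factor of the determinant that depends on both the starting and the end points. -/
noncomputable def couplingFactor {n : ℕ} (t : ℝ) (x y : Fin n → ℝ) : ℝ :=
  ∏ i, ∏ j, (1 - tanh (π * x i / (2 * t)) * tanh (π * y j / (2 * t)))⁻¹

section

variable {n : ℕ} (t : ℝ)

theorem det_sech_eq (x y : Fin n → ℝ) :
    (Matrix.of fun i j : Fin n => (1 / (2 * t)) * (cosh (π * (y j - x i) / (2 * t)))⁻¹).det =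
      ((1 / (2 * t)) ^ n * sechTanhDensity t x) * (sechTanhDensity t y * couplingFactor t x y) := by
  have h : (Matrix.of fun i j : Fin n => (1 / (2 * t)) * (cosh (π * (y j - x i) / (2 * t)))⁻¹) =
      Matrix.of fun i j => ((1 / (2 * t)) * (cosh (π * x i / (2 * t)))⁻¹) *
        Matrix.of (fun i j => (cosh (π * y j / (2 * t)))⁻¹ * Matrix.of (fun i j =>
          (1 - tanh (π * x i / (2 * t)) * tanh (π * y j / (2 * t)))⁻¹) i j) i j := by
    ext i j
    simp only [Matrix.of_apply]
    rw [mul_sub, sub_div, inv_cosh_sub, mul_assoc]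
  rw [h, Matrix.det_mul_column, Matrix.det_mul_row,
    Matrix.det_one_sub_mul_inv _ _ fun i j => (one_sub_tanh_mul_tanh_pos _ _).ne']
  simp only [sechTanhDensity, couplingFactor, prod_mul_distrib, prod_const, card_univ,
    Fintype.card_fin, filter_lt_eq_Ioi]
  ring

theorem continuous_sechTanhDensity : Continuous (sechTanhDensity (n := n) t) := by
  unfold sechTanhDensity
  have := continuous_tanh
  have h : Continuous fun x : ℝ => (cosh x)⁻¹ := continuous_cosh.inv₀ fun x => (cosh_pos x).ne'
  refine (continuous_finsetProd _ fun j _ => h.comp (by fun_prop)).mul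
    (continuous_finsetProd _ fun i _ => continuous_finsetProd _ fun j _ => ?_)
  exact (this.comp (by fun_prop)).sub (this.comp (by fun_prop))

theorem continuous_couplingFactor {X : Type*} [TopologicalSpace X] {f g : X → Fin n → ℝ}
    (hf : Continuous f) (hg : Continuous g) : Continuous fun p => couplingFactor t (f p) (g p) := by
  unfold couplingFactor
  refine continuous_finsetProd _ fun i _ => continuous_finsetProd _ fun j _ =>
    Continuous.inv₀ ?_ fun p => (one_sub_tanh_mul_tanh_pos _ _).ne'
  exact continuous_const.sub ((continuous_tanh.comp (by fun_prop)).mul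
    (continuous_tanh.comp (by fun_prop)))

theorem couplingFactor_zero_left (y : Fin n → ℝ) : couplingFactor t (fun _ => 0) y = 1 := by
  simp [couplingFactor]

theorem tendsto_mul_couplingFactor (y : Fin n → ℝ) :
    Tendsto (fun x => sechTanhDensity t y * couplingFactor t x y) (𝓝 (fun _ => 0))
      (𝓝 (sechTanhDensity t y)) := by
  have hc : Continuous fun x : Fin n → ℝ => couplingFactor t x y :=
    continuous_couplingFactor t continuous_id continuous_const
  simpa only [couplingFactor_zero_left, mul_one] using
    (hc.tendsto fun _ => 0).const_mul (sechTanhDensity t y)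

theorem eventually_couplingFactor_le :
    ∀ᶠ x in 𝓝 (fun _ : Fin n => (0 : ℝ)), ∀ y : Fin n → ℝ, |couplingFactor t x y| ≤ 2 ^ (n * n) := by
  have h : ∀ i : Fin n, ∀ᶠ x in 𝓝 (fun _ : Fin n => (0 : ℝ)), |tanh (π * x i / (2 * t))| < 1 / 2 := by
    intro i
    have hc : Continuous fun x : Fin n → ℝ => |tanh (π * x i / (2 * t))| :=
      (continuous_tanh.comp (by fun_prop)).abs
    have h0 : |tanh (π * (fun _ : Fin n => (0 : ℝ)) i / (2 * t))| < 1 / 2 := by simp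
    exact hc.continuousAt.eventually_lt_const h0
  filter_upwards [eventually_all.2 h] with x hx y
  have hpow : (2 : ℝ) ^ (n * n) = ∏ _i : Fin n, ∏ _j : Fin n, 2 := by simp [pow_mul]
  rw [couplingFactor, hpow]
  simp only [abs_prod]
  refine prod_le_prod (fun i _ => prod_nonneg fun j _ => abs_nonneg _) fun i _ =>
    prod_le_prod (fun j _ => abs_nonneg _) fun j _ => ?_
  have hpos := one_sub_tanh_mul_tanh_pos (π * x i / (2 * t)) (π * y j / (2 * t))
  have hle : |tanh (π * x i / (2 * t)) * tanh (π * y j / (2 * t))| ≤ 1 / 2 := by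
    rw [abs_mul]
    exact (mul_le_of_le_one_right (abs_nonneg _) (abs_tanh_lt_one _).le).trans (hx i).le
  rw [abs_of_pos (inv_pos.2 hpos), inv_le_comm₀ hpos two_pos]
  linarith [le_abs_self (tanh (π * x i / (2 * t)) * tanh (π * y j / (2 * t)))]

theorem sechTanhDensity_pos {t : ℝ} (ht : 0 < t) {y : Fin n → ℝ} (hy : StrictAnti y) :
    0 < sechTanhDensity t y := by
  refine mul_pos (prod_pos fun j _ => inv_pos.2 (cosh_pos _))
    (prod_pos fun i _ => prod_pos fun j hj => sub_pos.2 (strictMono_tanh ?_))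
  have := hy (mem_filter.1 hj).2
  gcongr

theorem integrable_sechTanhDensity {t : ℝ} (ht : 0 < t) :
    Integrable (sechTanhDensity (n := n) t) := by
  have hc : π / (2 * t) ≠ 0 := by positivity
  have h : Integrable fun y : Fin n → ℝ => ∏ j, (cosh (π * y j / (2 * t)))⁻¹ := by
    refine Integrable.fintype_prod (f := fun _ x => (cosh (π * x / (2 * t)))⁻¹) fun _ => ?_
    simpa only [div_mul_eq_mul_div] using integrable_inv_cosh.comp_mul_left' hc
  refine (h.mul_const (∏ i : Fin n, ∏ j ∈ univ.filter (fun j => i < j), 2)).mono'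
    (continuous_sechTanhDensity t).aestronglyMeasurable (.of_forall fun y => ?_)
  rw [sechTanhDensity, norm_mul, norm_of_nonneg (prod_nonneg fun j _ => (inv_pos.2 (cosh_pos _)).le)]
  refine mul_le_mul_of_nonneg_left ?_ (prod_nonneg fun j _ => (inv_pos.2 (cosh_pos _)).le)
  simp only [norm_prod]
  refine prod_le_prod (fun i _ => prod_nonneg fun j _ => norm_nonneg _) fun i _ =>
    prod_le_prod (fun j _ => norm_nonneg _) fun j _ => ?_
  refine (norm_sub_le _ _).trans ?_
  rw [norm_eq_abs, norm_eq_abs]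
  linarith [abs_tanh_lt_one (π * y i / (2 * t)), abs_tanh_lt_one (π * y j / (2 * t))]

theorem setIntegral_sechTanhDensity_pos {t : ℝ} (ht : 0 < t) {y : Fin n → ℝ} (hy : StrictAnti y) :
    0 < ∫ y' in {x : Fin n → ℝ | StrictAnti x}, sechTanhDensity t y' := by
  rw [setIntegral_pos_iff_support_of_nonneg_ae
    (ae_restrict_of_forall_mem isOpen_setOf_strictAnti.measurableSet
      fun y hy => (sechTanhDensity_pos ht hy).le) (integrable_sechTanhDensity ht).integrableOn,
    Set.inter_eq_right.2 (show {x : Fin n → ℝ | StrictAnti x} ⊆ Function.support (sechTanhDensity t) from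
      fun y hy => (sechTanhDensity_pos ht hy).ne')]
  exact isOpen_setOf_strictAnti.measure_pos _ ⟨y, hy⟩

theorem tendsto_setIntegral_mul_couplingFactor {t : ℝ} (ht : 0 < t) (C : Set (Fin n → ℝ)) :
    Tendsto (fun x => ∫ y in C, sechTanhDensity t y * couplingFactor t x y)
      (𝓝 (fun _ => 0)) (𝓝 (∫ y in C, sechTanhDensity t y)) := by
  refine tendsto_integral_filter_of_dominated_convergence
    (fun y => |sechTanhDensity t y| * 2 ^ (n * n)) (.of_forall fun x => ?_) ?_
    ((integrable_sechTanhDensity ht).abs.mul_const _).integrableOn (.of_forall fun y => ?_)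
  · exact ((continuous_sechTanhDensity t).mul (continuous_couplingFactor t
      continuous_const continuous_id)).aestronglyMeasurable
  · filter_upwards [eventually_couplingFactor_le t] with x hx
    refine .of_forall fun y => ?_
    rw [norm_mul, norm_eq_abs, norm_eq_abs]
    exact mul_le_mul_of_nonneg_left (hx y) (abs_nonneg _)
  · exact tendsto_mul_couplingFactor t y

end

/-- The normalized determinant of strip hitting densities converges, as the
starting points merge to 0 within the Weyl chamber C, to the stated
sech/tanh density. -/
theorem stmt_6 (n : ℕ) (t : ℝ) (ht : 0 < t)
    (C : Set (Fin n → ℝ)) (hC : C = {x : Fin n → ℝ | StrictAnti x})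
    (y : Fin n → ℝ) (hy : y ∈ C) :
    Tendsto
      (fun x : Fin n → ℝ =>
        Matrix.det (Matrix.of fun i j : Fin n =>
            (1 / (2 * t)) * (Real.cosh (Real.pi * (y j - x i) / (2 * t)))⁻¹) /
          ∫ y' in C, Matrix.det (Matrix.of fun i j : Fin n =>
            (1 / (2 * t)) * (Real.cosh (Real.pi * (y' j - x i) / (2 * t)))⁻¹))
      (nhdsWithin (fun _ => (0 : ℝ)) C)
      (nhds
        (((∏ j, (Real.cosh (Real.pi * y j / (2 * t)))⁻¹) *
            ∏ i, ∏ j ∈ Finset.univ.filter (fun j => i < j),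
              (Real.tanh (Real.pi * y i / (2 * t)) - Real.tanh (Real.pi * y j / (2 * t)))) /
          ∫ y' in C, (∏ j, (Real.cosh (Real.pi * y' j / (2 * t)))⁻¹) *
            ∏ i, ∏ j ∈ Finset.univ.filter (fun j => i < j),
              (Real.tanh (Real.pi * y' i / (2 * t)) - Real.tanh (Real.pi * y' j / (2 * t))))) := by
  subst hC
  have hy' : StrictAnti y := hy
  simp only [det_sech_eq, integral_const_mul]
  have hlim := ((tendsto_mul_couplingFactor t y).div
    (tendsto_setIntegral_mul_couplingFactor ht {x | StrictAnti x})
    (setIntegral_sechTanhDensity_pos ht hy').ne').mono_left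
      (nhdsWithin_le_nhds (s := {x : Fin n → ℝ | StrictAnti x}))
  refine hlim.congr' ?_
  filter_upwards [self_mem_nhdsWithin] with x hx
  have hx' := sechTanhDensity_pos ht (show StrictAnti x from hx)
  exact (mul_div_mul_left _ _ (by positivity)).symm
end

section
/- The limit as x → 0 (in the chamber {x_n < ... < x_1}) of the normalized Karlin-McGregor density p̂_t(x,y)/M_{t,x}, where p̂_t(x,y) = det(p_t(x_i,y_j)) with p_t the one-dimensional heat kernel, equals (1/M'_t) e^{-Σ y_i²/(2t)} ∏_{i<j}(y_j - y_i), i.e., the GOE eigenvalue density with variance parameter t. -/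
open Real Finset Filter MeasureTheory Topology
open scoped Matrix Matrix.Norms.Operator Nat

/-- The matrix of multiplication by `X` on polynomials modulo `∏ i, (X - x i)`, in the Newton basis
`∏ l < k, (X - x l)`. -/
def newtonMulMatrix {n : ℕ} (x : Fin n → ℝ) : Matrix (Fin n) (Fin n) ℝ :=
  Matrix.diagonal x + Matrix.of fun i k : Fin n => if (i : ℕ) = (k : ℕ) + 1 then (1 : ℝ) else 0

/-- The values at the nodes `x i` of the Newton basis polynomials `∏ l < k, (X - x l)`. -/
def newtonBasisMatrix {n : ℕ} (x : Fin n → ℝ) : Matrix (Fin n) (Fin n) ℝ :=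
  Matrix.of fun i k => ∏ l ∈ univ.filter (fun l => l < k), (x i - x l)

/-- The coordinates of the polynomial `1` in the Newton basis. -/
def newtonOne (n : ℕ) : Fin n → ℝ := fun i => if (i : ℕ) = 0 then 1 else 0

/-- The divided differences of `s ↦ exp (z * s)` at the nodes `x 0, …, x k`. -/
noncomputable def expDividedDiff {n : ℕ} (x : Fin n → ℝ) (z : ℝ) : Fin n → ℝ :=
  NormedSpace.exp (z • newtonMulMatrix x) *ᵥ newtonOne n

lemma det_newtonBasisMatrix_ne_zero {n : ℕ} {x : Fin n → ℝ} (hx : Function.Injective x) :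
    (newtonBasisMatrix x).det ≠ 0 := by
  rw [Matrix.det_of_isLowerTriangular]
  · refine prod_ne_zero_iff.2 fun i _ => ?_
    rw [newtonBasisMatrix, Matrix.of_apply]
    refine prod_ne_zero_iff.2 fun l hl => ?_
    exact sub_ne_zero.2 fun h => (mem_filter.1 hl).2.ne (hx h).symm
  · intro i k hik
    rw [newtonBasisMatrix, Matrix.of_apply]
    refine prod_eq_zero (i := i) ?_ (sub_self _)
    simpa using hik

lemma newtonBasisMatrix_mul_newtonMulMatrix {n : ℕ} (x : Fin n → ℝ) :
    newtonBasisMatrix x * newtonMulMatrix x = Matrix.diagonal x * newtonBasisMatrix x := by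
  ext i k
  rw [newtonMulMatrix, Matrix.mul_add, Matrix.add_apply, Matrix.mul_diagonal,
    Matrix.diagonal_mul, Matrix.mul_apply]
  refine eq_sub_iff_add_eq'.1 ?_
  rw [mul_comm (x i), ← mul_sub]
  by_cases hk : (k : ℕ) + 1 < n
  · rw [sum_eq_single ⟨k + 1, hk⟩]
    · have : univ.filter (fun l : Fin n => l < ⟨k + 1, hk⟩)
          = insert k (univ.filter (fun l : Fin n => l < k)) := by
        ext l
        simp only [mem_filter, mem_univ, true_and, mem_insert, Fin.lt_def, Fin.ext_iff]
        omega
      simp [newtonBasisMatrix, this, mul_comm]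
    · intro l _ hl
      simp [show (l : ℕ) ≠ k + 1 from fun h => hl (Fin.ext h)]
    · simp
  · rw [sum_eq_zero]
    · symm
      rcases eq_or_ne i k with rfl | hik
      · simp
      · have : i < k := by
          rw [Fin.lt_def]
          have := Fin.val_ne_of_ne hik
          omega
        rw [newtonBasisMatrix, Matrix.of_apply, prod_eq_zero (i := i) (by simpa using this)
          (sub_self _), zero_mul]
    · intro l _
      simp [show (l : ℕ) ≠ k + 1 by omega]

lemma newtonBasisMatrix_mulVec_newtonOne {n : ℕ} (x : Fin n → ℝ) :
    newtonBasisMatrix x *ᵥ newtonOne n = fun _ => 1 := by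
  ext i
  rw [Matrix.mulVec, dotProduct, sum_eq_single ⟨0, i.pos⟩]
  · have h : univ.filter (fun l : Fin n => l < ⟨0, i.pos⟩) = ∅ :=
      filter_false_of_mem fun l _ => Nat.not_lt_zero l
    simp [newtonBasisMatrix, newtonOne, h]
  · intro l _ hl
    simp [newtonOne, show (l : ℕ) ≠ 0 from fun h => hl (Fin.ext h)]
  · simp

lemma newtonBasisMatrix_mulVec_expDividedDiff {n : ℕ} (x : Fin n → ℝ) (z : ℝ) :
    newtonBasisMatrix x *ᵥ expDividedDiff x z = fun i => exp (x i * z) := by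
  have h : SemiconjBy (newtonBasisMatrix x) (z • newtonMulMatrix x)
      (Matrix.diagonal (z • x)) := by
    rw [SemiconjBy, Matrix.mul_smul, newtonBasisMatrix_mul_newtonMulMatrix,
      Matrix.diagonal_smul, Matrix.smul_mul]
  have h2 : newtonBasisMatrix x * NormedSpace.exp (z • newtonMulMatrix x) =
      NormedSpace.exp (Matrix.diagonal (z • x)) * newtonBasisMatrix x := h.exp_right.eq
  rw [expDividedDiff, Matrix.mulVec_mulVec, h2, ← Matrix.mulVec_mulVec,
    newtonBasisMatrix_mulVec_newtonOne, Matrix.exp_diagonal]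
  ext i
  rw [Matrix.mulVec_diagonal, Pi.coe_exp, ← Real.exp_eq_exp_ℝ]
  simp [mul_comm]

lemma hasSum_exp_mulVec {ι : Type*} [Fintype ι] [DecidableEq ι] (A : Matrix ι ι ℝ) (v : ι → ℝ) :
    HasSum (fun m : ℕ => (m ! : ℝ)⁻¹ • (A ^ m *ᵥ v)) (NormedSpace.exp A *ᵥ v) := by
  have h₀ : HasSum (fun m : ℕ => (m ! : ℝ)⁻¹ • A ^ m) (NormedSpace.exp A) :=
    NormedSpace.exp_series_hasSum_exp' A
  have h := h₀.map (AddMonoidHom.mk' (fun B : Matrix ι ι ℝ => B *ᵥ v)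
      fun B₁ B₂ => Matrix.add_mulVec B₁ B₂ v)
    (continuous_id.matrix_mulVec continuous_const)
  simp only [Function.comp_def, AddMonoidHom.mk'_apply, Matrix.smul_mulVec] at h
  exact h

lemma norm_exp_mulVec_le {ι : Type*} [Fintype ι] [DecidableEq ι] (A : Matrix ι ι ℝ) (v : ι → ℝ) :
    ‖NormedSpace.exp A *ᵥ v‖ ≤ exp ‖A‖ * ‖v‖ := by
  have hpow : ∀ m : ℕ, ‖A ^ m *ᵥ v‖ ≤ ‖A‖ ^ m * ‖v‖ := by
    intro m
    induction m with
    | zero => simp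
    | succ m ih =>
      rw [pow_succ', ← Matrix.mulVec_mulVec, pow_succ', mul_assoc]
      exact (Matrix.linfty_opNorm_mulVec _ _).trans (by gcongr)
  have hs := (NormedSpace.expSeries_div_hasSum_exp ‖A‖).mul_right ‖v‖
  rw [← Real.exp_eq_exp_ℝ] at hs
  refine (hasSum_exp_mulVec A v).norm_le_of_bounded hs fun m => ?_
  rw [norm_smul, norm_inv, Real.norm_natCast, div_mul_eq_mul_div, div_eq_inv_mul]
  gcongr
  exact hpow m

lemma continuous_newtonMulMatrix {n : ℕ} :
    Continuous (newtonMulMatrix : (Fin n → ℝ) → Matrix (Fin n) (Fin n) ℝ) := by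
  unfold newtonMulMatrix
  exact (continuous_id.matrix_diagonal).add continuous_const

lemma continuous_expDividedDiff {n : ℕ} :
    Continuous fun p : (Fin n → ℝ) × ℝ => expDividedDiff p.1 p.2 :=
  (NormedSpace.exp_continuous.comp
    (continuous_snd.smul (continuous_newtonMulMatrix.comp continuous_fst))).matrix_mulVec
      continuous_const

lemma norm_expDividedDiff_le {n : ℕ} (x : Fin n → ℝ) (z : ℝ) :
    ‖expDividedDiff x z‖ ≤ exp (‖newtonMulMatrix x‖ * |z|) := by
  refine (norm_exp_mulVec_le _ _).trans ?_
  rw [norm_smul, Real.norm_eq_abs, mul_comm |z|]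
  refine mul_le_of_le_one_right (exp_pos _).le
    ((pi_norm_le_iff_of_nonneg zero_le_one).2 fun i => ?_)
  by_cases h : (i : ℕ) = 0 <;> simp [newtonOne, h]

lemma expDividedDiff_zero {n : ℕ} (z : ℝ) (k : Fin n) :
    expDividedDiff (fun _ => 0) z k = ((k : ℕ)! : ℝ)⁻¹ * z ^ (k : ℕ) := by
  have hpow : ∀ m : ℕ, newtonMulMatrix (fun _ : Fin n => (0 : ℝ)) ^ m *ᵥ newtonOne n
      = fun i : Fin n => if (i : ℕ) = m then (1 : ℝ) else 0 := by
    intro m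
    induction m with
    | zero => simp [newtonOne, funext_iff]
    | succ m ih =>
      rw [pow_succ', ← Matrix.mulVec_mulVec, ih]
      ext i
      simp only [newtonMulMatrix, Matrix.mulVec, dotProduct, Matrix.diagonal_zero, zero_add,
        Matrix.of_apply, mul_ite, mul_one, mul_zero]
      split_ifs with hi
      · rw [sum_eq_single ⟨m, by omega⟩]
        · simp [hi]
        · intro l _ hl
          simp [show (l : ℕ) ≠ m from fun h => hl (Fin.ext h)]
        · simp
      · refine sum_eq_zero fun l _ => ?_
        split_ifs <;> first | rfl | omega
  have h := Pi.hasSum.1 (hasSum_exp_mulVec (z • newtonMulMatrix fun _ : Fin n => (0 : ℝ))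
    (newtonOne n)) k
  refine h.unique ?_
  convert hasSum_single (k : ℕ) ?_ using 1
  · simp [smul_pow, Matrix.smul_mulVec, hpow]
  · intro m hm
    simp [smul_pow, Matrix.smul_mulVec, hpow, hm.symm]

lemma abs_det_le_of_forall_col_le {ι : Type*} [Fintype ι] [DecidableEq ι] (M : Matrix ι ι ℝ)
    (b : ι → ℝ) (h : ∀ i j, |M i j| ≤ b j) :
    |M.det| ≤ (Fintype.card ι)! * ∏ j, b j := by
  rw [Matrix.det_apply]
  refine (abs_sum_le_sum_abs _ _).trans ?_
  calc _ ≤ ∑ _σ : Equiv.Perm ι, ∏ j, b j := by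
        refine sum_le_sum fun σ _ => ?_
        rw [Units.smul_def, zsmul_eq_mul, abs_mul, abs_prod]
        rcases Int.units_eq_one_or (Equiv.Perm.sign σ) with hσ | hσ <;>
        · simp only [hσ, Units.val_one, Units.val_neg, Int.cast_one, Int.cast_neg, abs_neg,
            abs_one, one_mul]
          exact prod_le_prod (fun _ _ => abs_nonneg _) fun j _ => h _ _
    _ = _ := by simp [Fintype.card_perm]

lemma integrable_exp_neg_mul_sq_add_mul_abs {b : ℝ} (hb : 0 < b) (c : ℝ) :
    Integrable fun s : ℝ => exp (-b * s ^ 2 + c * |s|) := by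
  refine ((integrable_exp_neg_mul_sq (half_pos hb)).const_mul (exp (c ^ 2 / (2 * b)))).mono'
    (by fun_prop) (ae_of_all _ fun s => ?_)
  rw [Real.norm_eq_abs, abs_exp, ← exp_add, exp_le_exp]
  have h : 0 ≤ (b * |s| - c) ^ 2 / (2 * b) := by positivity
  have h2 : (b * |s| - c) ^ 2 / (2 * b) = b / 2 * s ^ 2 - c * |s| + c ^ 2 / (2 * b) := by
    rw [← sq_abs s]
    field_simp
    ring
  linarith

/-- The kernel obtained from `det (exp (-(x i - y j) ^ 2 / (2 * t)))` by removing the factors that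
depend only on `x`. -/
noncomputable def reducedKernel {n : ℕ} (t : ℝ) (x y : Fin n → ℝ) : ℝ :=
  exp (-(∑ i, y i ^ 2) / (2 * t)) *
    (Matrix.of fun k j : Fin n => expDividedDiff x (y j / t) k).det

lemma det_heatKernel_eq {n : ℕ} {t : ℝ} (ht : 0 < t) (x y : Fin n → ℝ) :
    (Matrix.of fun i j : Fin n =>
        (√(2 * π * t))⁻¹ * exp (-(x i - y j) ^ 2 / (2 * t))).det =
      (∏ i, (√(2 * π * t))⁻¹ * exp (-x i ^ 2 / (2 * t))) * (newtonBasisMatrix x).det *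
        reducedKernel t x y := by
  have h : (newtonBasisMatrix x) * (Matrix.of fun k j : Fin n => expDividedDiff x (y j / t) k)
      = Matrix.of fun i j : Fin n => exp (x i * (y j / t)) := by
    ext i j
    exact congrFun (newtonBasisMatrix_mulVec_expDividedDiff x (y j / t)) i
  have h2 : exp (-(∑ i, y i ^ 2) / (2 * t)) = ∏ j, exp (-y j ^ 2 / (2 * t)) := by
    rw [← exp_sum, ← sum_div, sum_neg_distrib]
  have h3 : ∀ a b c d : ℝ, a * b * (c * d) = a * (c * (b * d)) := fun a b c d => by ring
  rw [reducedKernel, h3, ← Matrix.det_mul, h, h2,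
    ← Matrix.det_mul_row (fun j => exp (-y j ^ 2 / (2 * t))),
    ← Matrix.det_mul_column (fun i => (√(2 * π * t))⁻¹ * exp (-x i ^ 2 / (2 * t)))]
  congr 1
  ext i j
  simp only [Matrix.of_apply]
  rw [← exp_add, mul_assoc (√(2 * π * t))⁻¹, ← exp_add]
  congr 2
  field_simp
  ring

lemma continuous_reducedKernel {n : ℕ} (t : ℝ) :
    Continuous fun p : (Fin n → ℝ) × (Fin n → ℝ) => reducedKernel t p.1 p.2 := by
  refine Continuous.mul (by fun_prop) (Continuous.matrix_det (continuous_matrix fun k j => ?_))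
  have h : Continuous fun p : (Fin n → ℝ) × (Fin n → ℝ) => (p.1, p.2 j / t) := by fun_prop
  exact (continuous_apply k).comp (continuous_expDividedDiff.comp h)

lemma abs_reducedKernel_le {n : ℕ} {t K : ℝ} (ht : 0 < t) {x : Fin n → ℝ}
    (hx : ‖newtonMulMatrix x‖ ≤ K) (y : Fin n → ℝ) :
    |reducedKernel t x y| ≤ n ! * ∏ j, exp (-(1 / (2 * t)) * y j ^ 2 + K / t * |y j|) := by
  have h := abs_det_le_of_forall_col_le
    (Matrix.of fun k j : Fin n => expDividedDiff x (y j / t) k)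
    (fun j => exp (K / t * |y j|)) fun k j => by
      refine ((norm_le_pi_norm _ k).trans (norm_expDividedDiff_le x (y j / t))).trans ?_
      rw [exp_le_exp, abs_div, abs_of_pos ht, div_mul_eq_mul_div, ← mul_div_assoc]
      gcongr
  have h2 : exp (-(∑ i, y i ^ 2) / (2 * t)) = ∏ j, exp (-(1 / (2 * t)) * y j ^ 2) := by
    rw [← exp_sum, ← mul_sum]
    ring_nf
  rw [reducedKernel, abs_mul, abs_exp]
  simp_rw [exp_add]
  rw [prod_mul_distrib, h2, mul_left_comm]
  rw [Fintype.card_fin] at h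
  gcongr

lemma integrable_reducedKernel_bound {n : ℕ} {t : ℝ} (ht : 0 < t) (K : ℝ) :
    Integrable fun y : Fin n → ℝ =>
      (n ! : ℝ) * ∏ j, exp (-(1 / (2 * t)) * y j ^ 2 + K / t * |y j|) :=
  (Integrable.fintype_prod fun _ =>
    integrable_exp_neg_mul_sq_add_mul_abs (by positivity) _).const_mul _

lemma reducedKernel_zero {n : ℕ} (t : ℝ) (y : Fin n → ℝ) :
    reducedKernel t (fun _ => 0) y =
      (∏ k : Fin n, ((k : ℕ)! : ℝ)⁻¹ * t⁻¹ ^ (k : ℕ)) *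
        (exp (-(∑ i, y i ^ 2) / (2 * t)) *
          ∏ i, ∏ j ∈ univ.filter (fun j => i < j), (y j - y i)) := by
  have h : (Matrix.of fun k j : Fin n => expDividedDiff (fun _ => 0) (y j / t) k)
      = Matrix.of fun k j : Fin n => (((k : ℕ)! : ℝ)⁻¹ * t⁻¹ ^ (k : ℕ)) *
        (Matrix.vandermonde y)ᵀ k j := by
    ext k j
    simp only [Matrix.of_apply, expDividedDiff_zero, Matrix.transpose_apply,
      Matrix.vandermonde_apply, div_eq_mul_inv, mul_pow]
    ring
  rw [reducedKernel, h, Matrix.det_mul_column, Matrix.det_transpose, Matrix.det_vandermonde,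
    mul_left_comm]
  simp only [filter_lt_eq_Ioi]

lemma isOpen_setOf_strictAnti_s15 {n : ℕ} : IsOpen {y : Fin n → ℝ | StrictAnti y} := by
  have : {y : Fin n → ℝ | StrictAnti y} = ⋂ i, ⋂ j, ⋂ _ : i < j, {y | y j < y i} := by
    ext y
    simp [StrictAnti]
  rw [this]
  exact isOpen_iInter_of_finite fun i => isOpen_iInter_of_finite fun j =>
    isOpen_iInter_of_finite fun _ => isOpen_lt (continuous_apply j) (continuous_apply i)

lemma tendsto_setIntegral_reducedKernel {n : ℕ} {t : ℝ} (ht : 0 < t) (C : Set (Fin n → ℝ))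
    (x₀ : Fin n → ℝ) :
    Tendsto (fun x => ∫ y in C, reducedKernel t x y) (𝓝 x₀)
      (𝓝 (∫ y in C, reducedKernel t x₀ y)) := by
  refine tendsto_integral_filter_of_dominated_convergence _
    (Eventually.of_forall fun x => ?_) ?_
    (integrable_reducedKernel_bound ht (‖newtonMulMatrix x₀‖ + 1)).integrableOn
    (ae_of_all _ fun y => ?_)
  · exact ((continuous_reducedKernel t).comp
      (continuous_const.prodMk continuous_id)).aestronglyMeasurable
  · filter_upwards [(continuous_newtonMulMatrix (n := n)).norm.continuousAt.eventually_lt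
      continuousAt_const (lt_add_one ‖newtonMulMatrix x₀‖)] with x hx
    exact ae_of_all _ fun y => abs_reducedKernel_le ht hx.le y
  · exact ((continuous_reducedKernel t).comp (continuous_id.prodMk continuous_const)).tendsto x₀

lemma integrable_reducedKernel {n : ℕ} {t : ℝ} (ht : 0 < t) (x : Fin n → ℝ) :
    Integrable (reducedKernel t x) :=
  (integrable_reducedKernel_bound ht ‖newtonMulMatrix x‖).mono'
    ((continuous_reducedKernel t).comp
      (continuous_const.prodMk continuous_id)).aestronglyMeasurable
    (ae_of_all _ fun y => abs_reducedKernel_le ht le_rfl y)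

lemma prod_prod_sub_eq_neg_one_pow_mul {n : ℕ} (y : Fin n → ℝ) :
    ∏ i, ∏ j ∈ univ.filter (fun j => i < j), (y j - y i) =
      (∏ i : Fin n, (-1) ^ #(univ.filter (fun j => i < j))) *
        ∏ i, ∏ j ∈ univ.filter (fun j => i < j), (y i - y j) := by
  rw [← prod_mul_distrib]
  refine prod_congr rfl fun i _ => ?_
  rw [← prod_const, ← prod_mul_distrib]
  exact prod_congr rfl fun j _ => by ring

lemma setIntegral_reducedKernel_zero_ne_zero {n : ℕ} {t : ℝ} (ht : 0 < t)
    (hne : {y : Fin n → ℝ | StrictAnti y}.Nonempty) :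
    ∫ y in {y : Fin n → ℝ | StrictAnti y}, reducedKernel t (fun _ => 0) y ≠ 0 := by
  set C := {y : Fin n → ℝ | StrictAnti y}
  set c : ℝ := (∏ k : Fin n, ((k : ℕ)! : ℝ)⁻¹ * t⁻¹ ^ (k : ℕ)) *
    ∏ i : Fin n, (-1) ^ #(univ.filter (fun j => i < j)) with hc
  have hc0 : c ≠ 0 := by
    refine mul_ne_zero (prod_ne_zero_iff.2 fun k _ => by positivity)
      (prod_ne_zero_iff.2 fun i _ => pow_ne_zero _ (by norm_num))
  have heq : ∀ y : Fin n → ℝ, reducedKernel t (fun _ => 0) y =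
      c * (exp (-(∑ i, y i ^ 2) / (2 * t)) * ∏ i, ∏ j ∈ univ.filter (fun j => i < j), (y i - y j)) := fun y => by
    rw [reducedKernel_zero, prod_prod_sub_eq_neg_one_pow_mul, hc]
    ring
  have hpos : ∀ y ∈ C, 0 < c⁻¹ * reducedKernel t (fun _ => 0) y := fun y hy => by
    rw [heq, inv_mul_cancel_left₀ hc0]
    exact mul_pos (exp_pos _) (prod_pos fun i _ => prod_pos fun j hj =>
      sub_pos.2 (hy (mem_filter.1 hj).2))
  have hC : IsOpen C := isOpen_setOf_strictAnti_s15
  have h : 0 < ∫ y in C, c⁻¹ * reducedKernel t (fun _ => 0) y := by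
    rw [setIntegral_pos_iff_support_of_nonneg_ae
      (ae_restrict_of_forall_mem hC.measurableSet fun y hy => (hpos y hy).le)
      ((integrable_reducedKernel ht _).const_mul _).integrableOn,
      Set.inter_eq_self_of_subset_right (s := Function.support _) fun y hy => (hpos y hy).ne']
    exact hC.measure_pos _ hne
  rw [integral_const_mul] at h
  exact right_ne_zero_of_mul h.ne'

/-- The normalized Karlin-McGregor density for n one-dimensional Brownian
motions converges, as the starting points merge to 0 within the chamber C,
to the GOE eigenvalue density with variance parameter t. -/
theorem stmt_15 (n : ℕ) (t : ℝ) (ht : 0 < t)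
    (C : Set (Fin n → ℝ)) (hC : C = {y : Fin n → ℝ | StrictAnti y})
    (y : Fin n → ℝ) (hy : y ∈ C) :
    Tendsto
      (fun x : Fin n → ℝ =>
        Matrix.det (Matrix.of fun i j : Fin n =>
            (Real.sqrt (2 * Real.pi * t))⁻¹ * Real.exp (-(x i - y j) ^ 2 / (2 * t))) /
          ∫ y' in C, Matrix.det (Matrix.of fun i j : Fin n =>
            (Real.sqrt (2 * Real.pi * t))⁻¹ * Real.exp (-(x i - y' j) ^ 2 / (2 * t))))
      (nhdsWithin (fun _ => (0 : ℝ)) C)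
      (nhds
        ((Real.exp (-(∑ i, (y i) ^ 2) / (2 * t)) *
            ∏ i, ∏ j ∈ Finset.univ.filter (fun j => i < j), (y j - y i)) /
          ∫ y' in C, Real.exp (-(∑ i, (y' i) ^ 2) / (2 * t)) *
            ∏ i, ∏ j ∈ Finset.univ.filter (fun j => i < j), (y' j - y' i))) := by
  subst hC
  have h0 := setIntegral_reducedKernel_zero_ne_zero ht ⟨y, hy⟩
  have hlim : Tendsto (fun x => reducedKernel t x y /
      ∫ y' in {y : Fin n → ℝ | StrictAnti y}, reducedKernel t x y') (𝓝 fun _ => 0) _ :=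
    (((continuous_reducedKernel t).comp (continuous_id.prodMk continuous_const)).tendsto
      fun _ => 0).div (tendsto_setIntegral_reducedKernel ht _ _) h0
  have hc : (∏ k : Fin n, ((k : ℕ)! : ℝ)⁻¹ * t⁻¹ ^ (k : ℕ)) ≠ 0 :=
    prod_ne_zero_iff.2 fun k _ => by positivity
  simp only [Function.comp_apply, id_eq, reducedKernel_zero] at hlim
  rw [integral_const_mul, mul_div_mul_left _ _ hc] at hlim
  refine (hlim.mono_left nhdsWithin_le_nhds).congr' ?_
  filter_upwards [self_mem_nhdsWithin] with x hx
  have hx0 : (∏ i, (√(2 * π * t))⁻¹ * exp (-x i ^ 2 / (2 * t))) *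
      (newtonBasisMatrix x).det ≠ 0 :=
    mul_ne_zero (prod_ne_zero_iff.2 fun i _ => by positivity)
      (det_newtonBasisMatrix_ne_zero (StrictAnti.injective hx))
  simp only [det_heatKernel_eq ht]
  rw [integral_const_mul, mul_div_mul_left _ _ hx0]
end

section
/- The Poisson summation identity: Σ_{k∈ℤ} e^{2πixk} · (1/(2L)) sech(π(ν − θ + 2πk)/(2L)) = (1/(2π)) Σ_{k∈ℤ} sech(L(x+k)) e^{-i(ν-θ)(x+k)}, where L = |log r| for 0 < r < 1. -/
open Real Complex
open Filter Asymptotics MeasureTheory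
open scoped FourierTransform

theorem Real.one_add_sq_div_four_le_cosh (y : ℝ) : 1 + y ^ 2 / 4 ≤ Real.cosh y := by
  rw [← Real.cosh_abs, ← sq_abs, Real.cosh_eq]
  linarith [Real.quadratic_le_exp_of_nonneg (abs_nonneg y), Real.add_one_le_exp (-|y|)]

/-- The hyperbolic secant of a nonconstant affine function decays faster than `|w| ^ (-2)`. -/
theorem isBigO_inv_cosh_affine (c : ℝ) {d : ℝ} (hd : d ≠ 0) :
    (fun w : ℝ => (Real.cosh (c + d * w))⁻¹) =O[cocompact ℝ] fun w : ℝ => |w| ^ (-2 : ℝ) := by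
  refine IsBigO.of_bound ((8 + 2 * c ^ 2) / d ^ 2) ?_
  have hne : ∀ᶠ w : ℝ in cocompact ℝ, w ≠ 0 :=
    isCompact_singleton.compl_mem_cocompact
  filter_upwards [hne] with w hw
  have hw2 : 0 < w ^ 2 := by positivity
  have hd2 : 0 < d ^ 2 := by positivity
  have hpow : |w| ^ (-2 : ℝ) = (w ^ 2)⁻¹ := by
    rw [Real.rpow_neg (abs_nonneg w), Real.rpow_two, sq_abs]
  rw [hpow, Real.norm_of_nonneg (inv_nonneg.2 (Real.cosh_pos _).le),
    Real.norm_of_nonneg (inv_nonneg.2 hw2.le), ← div_eq_mul_inv, div_div,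
    inv_le_comm₀ (Real.cosh_pos _) (by positivity), inv_div]
  refine le_trans ?_ (Real.one_add_sq_div_four_le_cosh _)
  rw [div_le_iff₀ (by positivity)]
  nlinarith [sq_nonneg (c + d * w + c), sq_nonneg (c * (c + d * w))]

/-- Pulling the Beta integrand back along the sigmoid function. -/
theorem sigmoid_mul_betaIntegrand (η s : ℝ) :
    ((Real.sigmoid s * (1 - Real.sigmoid s) : ℝ) : ℂ) *
      ((Real.sigmoid s : ℂ) ^ ((1 / 2 + η * Complex.I : ℂ) - 1) *
        (1 - (Real.sigmoid s : ℂ)) ^ ((1 / 2 - η * Complex.I : ℂ) - 1)) =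
      Complex.exp (η * s * Complex.I) * ((Real.cosh (s / 2) : ℂ))⁻¹ / 2 := by
  have hσ := Real.sigmoid_pos s
  have hσ' : 1 - Real.sigmoid s = Real.sigmoid s * Real.exp (-s) := by
    rw [Real.sigmoid_mul_rexp_neg, Real.sigmoid_neg]
  have hlog : Real.log (1 - Real.sigmoid s) = Real.log (Real.sigmoid s) - s := by
    rw [hσ', Real.log_mul hσ.ne' (Real.exp_ne_zero _), Real.log_exp]; ring
  have hσ1 : 0 < 1 - Real.sigmoid s := by linarith [Real.sigmoid_lt_one s]
  have hexp : Complex.exp (Real.log (Real.sigmoid s) : ℝ) = Real.sigmoid s := by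
    rw [← Complex.ofReal_exp, Real.exp_log hσ]
  have hsech : (1 - Real.sigmoid s) * Real.exp (s / 2) = (Real.cosh (s / 2))⁻¹ / 2 := by
    have hs : Real.exp (-s) = (Real.exp (s / 2) * Real.exp (s / 2))⁻¹ := by
      rw [← Real.exp_add, ← Real.exp_neg]; ring_nf
    rw [hσ', Real.sigmoid_def, Real.cosh_eq, hs, Real.exp_neg]
    field_simp
  have hσ0 : (Real.sigmoid s : ℂ) ≠ 0 := by exact_mod_cast hσ.ne'
  have hσ10 : (1 - Real.sigmoid s : ℂ) ≠ 0 := by exact_mod_cast hσ1.ne'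
  have hsechC := congrArg (fun t : ℝ => (t : ℂ)) hsech
  push_cast at hsechC
  have hlog1 : Complex.log (1 - Real.sigmoid s) = Real.log (Real.sigmoid s) - s := by
    rw [← Complex.ofReal_sub, ← hlog, Complex.ofReal_log hσ1.le]; push_cast; rfl
  rw [Complex.cpow_def_of_ne_zero hσ0, Complex.cpow_def_of_ne_zero hσ10, hlog1,
    ← Complex.ofReal_log hσ.le, ← Complex.exp_add]
  have harg : (Real.log (Real.sigmoid s) : ℂ) * ((1 / 2 + η * Complex.I : ℂ) - 1) +
      ((Real.log (Real.sigmoid s) : ℂ) - s) * ((1 / 2 - η * Complex.I : ℂ) - 1) =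
      -(Real.log (Real.sigmoid s) : ℂ) + η * s * Complex.I + s / 2 := by ring
  rw [harg, Complex.exp_add, Complex.exp_add, Complex.exp_neg, hexp]
  push_cast
  field_simp
  linear_combination 2 * hsechC

/-- The Fourier transform of the hyperbolic secant. -/
theorem integral_exp_mul_inv_cosh (η : ℝ) :
    ∫ s : ℝ, Complex.exp (η * s * Complex.I) * ((Real.cosh (s / 2) : ℂ))⁻¹ / 2 =
      Real.pi * ((Real.cosh (Real.pi * η) : ℂ))⁻¹ := by
  have hbeta : Complex.betaIntegral (1 / 2 + η * Complex.I) (1 / 2 - η * Complex.I) =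
      Real.pi * ((Real.cosh (Real.pi * η) : ℂ))⁻¹ := by
    have h := Complex.Gamma_mul_Gamma_eq_betaIntegral
      (s := 1 / 2 + η * Complex.I) (t := 1 / 2 - η * Complex.I) (by simp) (by simp)
    have h1 : (1 / 2 - η * Complex.I : ℂ) = 1 - (1 / 2 + η * Complex.I) := by ring
    have h2 : (1 / 2 + η * Complex.I : ℂ) + (1 - (1 / 2 + η * Complex.I)) = 1 := by ring
    rw [h1, Complex.Gamma_mul_Gamma_one_sub, h2, Complex.Gamma_one, one_mul] at h
    have h3 : (Real.pi : ℂ) * (1 / 2 + η * Complex.I) =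
        (Real.pi * η : ℝ) * Complex.I + Real.pi / 2 := by push_cast; ring
    rw [h1, ← h, h3, Complex.sin_add_pi_div_two, Complex.cos_mul_I, div_eq_mul_inv,
      Complex.ofReal_cosh]
  rw [← hbeta, Complex.betaIntegral, intervalIntegral.integral_of_le zero_le_one,
    integral_Ioc_eq_integral_Ioo, ← Real.range_sigmoid, ← Set.image_univ,
    integral_image_eq_integral_abs_deriv_smul MeasurableSet.univ
      (fun s _ => (Real.hasDerivAt_sigmoid s).hasDerivWithinAt)
      Real.sigmoid_injective.injOn, setIntegral_univ]
  congr 1 with s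
  rw [abs_of_pos (mul_pos (Real.sigmoid_pos s) (by linarith [Real.sigmoid_lt_one s])),
    Complex.real_smul, sigmoid_mul_betaIntegrand]

theorem fourier_inv_cosh_mul_exp {L : ℝ} (hL : 0 < L) (u w : ℝ) :
    𝓕 (fun t : ℝ => (((Real.cosh (L * t))⁻¹ : ℝ) : ℂ) * Complex.exp (-Complex.I * u * t)) w =
      (((Real.pi / L) * (Real.cosh (Real.pi * (u + 2 * Real.pi * w) / (2 * L)))⁻¹ : ℝ) : ℂ) := by
  have h := Measure.integral_comp_mul_left
    (fun s : ℝ => Complex.exp ((-(u + 2 * Real.pi * w) / (2 * L) : ℝ) * s * Complex.I) *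
      ((Real.cosh (s / 2) : ℂ))⁻¹ / 2) (2 * L)
  rw [integral_exp_mul_inv_cosh, abs_of_pos (by positivity)] at h
  have hcosh : Real.cosh (Real.pi * (-(u + 2 * Real.pi * w) / (2 * L))) =
      Real.cosh (Real.pi * (u + 2 * Real.pi * w) / (2 * L)) := by
    rw [← Real.cosh_neg]; congr 1; ring
  have hLC : (L : ℂ) ≠ 0 := by exact_mod_cast hL.ne'
  rw [hcosh, Complex.real_smul] at h
  rw [Real.fourier_real_eq_integral_exp_smul]
  calc _ = ∫ t : ℝ, 2 * (Complex.exp ((-(u + 2 * Real.pi * w) / (2 * L) : ℝ) *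
        (2 * L * t : ℝ) * Complex.I) * ((Real.cosh (2 * L * t / 2) : ℂ))⁻¹ / 2) := by
        congr 1 with t
        have harg : 2 * L * t / 2 = L * t := by ring
        rw [harg, smul_eq_mul, mul_left_comm, ← Complex.exp_add]
        have hexp : ((-2 * Real.pi * t * w : ℝ) : ℂ) * Complex.I + -Complex.I * u * t =
            (-(u + 2 * Real.pi * w) / (2 * L) : ℝ) * (2 * L * t : ℝ) * Complex.I := by
          push_cast; field_simp; ring
        rw [← hexp]; push_cast; ring
    _ = _ := by
        rw [integral_const_mul, h]; push_cast; field_simp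

/-- Poisson summation for the hyperbolic secant, with arbitrary real shift `x`. -/
theorem tsum_inv_cosh_mul_exp {L : ℝ} (hL : 0 < L) (u x : ℝ) :
    ∑' k : ℤ, (((Real.cosh (L * (x + k)))⁻¹ : ℝ) : ℂ) *
        Complex.exp (-Complex.I * u * ((x + k : ℝ) : ℂ)) =
      ∑' k : ℤ,
        (((Real.pi / L) * (Real.cosh (Real.pi * (u + 2 * Real.pi * k) / (2 * L)))⁻¹ : ℝ) : ℂ) *
          Complex.exp (2 * Real.pi * Complex.I * k * x) := by
  have hc : Continuous fun t : ℝ =>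
      (((Real.cosh (L * t))⁻¹ : ℝ) : ℂ) * Complex.exp (-Complex.I * u * t) := by
    have : Continuous fun t : ℝ => (Real.cosh (L * t))⁻¹ :=
      (Real.continuous_cosh.comp (by fun_prop)).inv₀ fun t => (Real.cosh_pos _).ne'
    fun_prop
  have hf : (fun t : ℝ => (((Real.cosh (L * t))⁻¹ : ℝ) : ℂ) * Complex.exp (-Complex.I * u * t))
      =O[cocompact ℝ] fun t : ℝ => |t| ^ (-2 : ℝ) := by
    refine (isBigO_of_le _ fun t => ?_).trans (isBigO_inv_cosh_affine 0 hL.ne')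
    rw [norm_mul, Complex.norm_real, Complex.norm_exp]
    simp
  have hF : (𝓕 fun t : ℝ =>
      (((Real.cosh (L * t))⁻¹ : ℝ) : ℂ) * Complex.exp (-Complex.I * u * t))
      =O[cocompact ℝ] fun t : ℝ => |t| ^ (-2 : ℝ) := by
    have hd : Real.pi * (2 * Real.pi) / (2 * L) ≠ 0 := by positivity
    refine (isBigO_of_le _ fun w => ?_).trans
      ((isBigO_inv_cosh_affine (Real.pi * u / (2 * L)) hd).const_mul_left (Real.pi / L))
    rw [fourier_inv_cosh_mul_exp hL, Complex.norm_real]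
    apply le_of_eq
    congr 4
    ring
  have h := Real.tsum_eq_tsum_fourier_of_rpow_decay hc one_lt_two hf hF x
  simpa only [fourier_inv_cosh_mul_exp hL, fourier_coe_apply, Complex.ofReal_one, div_one] using h

/-- Poisson summation identity for the sech kernel in the annulus setting:
Σ_k e^{2πixk}·(1/(2L))sech(π(ν-θ+2πk)/(2L)) =
(1/(2π))Σ_k sech(L(x+k))e^{-i(ν-θ)(x+k)}, with L = |log r|, 0 < r < 1. -/
theorem stmt_16 (r : ℝ) (hr0 : 0 < r) (hr1 : r < 1) (θ ν : ℝ)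
    (x : ℝ) (hx : x = 0 ∨ x = 1 / 2) (L : ℝ) (hL : L = |Real.log r|) :
    (∑' k : ℤ, Complex.exp (2 * Real.pi * Complex.I * x * k) *
        (((1 / (2 * L)) * (Real.cosh (Real.pi * (ν - θ + 2 * Real.pi * k) / (2 * L)))⁻¹ : ℝ) : ℂ)) =
      (1 / (2 * (Real.pi : ℂ))) *
        ∑' k : ℤ, (((Real.cosh (L * (x + k)))⁻¹ : ℝ) : ℂ) *
          Complex.exp (-Complex.I * ((ν : ℂ) - (θ : ℂ)) * ((x : ℂ) + (k : ℂ))) := by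
  have hLpos : 0 < L := hL ▸ abs_pos.2 (Real.log_neg hr0 hr1).ne
  have hLC : (L : ℂ) ≠ 0 := by exact_mod_cast hLpos.ne'
  have hpi : (Real.pi : ℂ) ≠ 0 := by exact_mod_cast Real.pi_ne_zero
  have h := tsum_inv_cosh_mul_exp hLpos (ν - θ) x
  push_cast at h ⊢
  rw [h, ← tsum_mul_left]
  congr 1 with k
  rw [mul_right_comm _ (x : ℂ)]
  field_simp
end
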